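/- Let m ≥ 1 and let (a_1,…,a_n) be a sequence of positive integers, with associated border strip 𝒢 = 𝒢[a_1,…,a_n]. Let X = Λ_m(a_1)Λ_m(a_2)⋯Λ_m(a_n) be the product of the (m+1)×(m+1) integer matrices Λ_m(a_k). Then for all 1 ≤ i,j ≤ m+1: if n is even, X_{ij} equals the number of P-partitions σ on 𝒢 with parts at most m satisfying σ(1) ≤ m+1−i and σ(N) ≤ m+1−j; and if n is odd, X_{ij} equals the number of such σ satisfying σ(1) ≤ m+1−i and σ(N) ≥ j−1. In particular, X_{11} equals the total number of P-partitions on 𝒢 with parts at most m. -/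

import Mathlib

open Polynomial Finset

namespace QHCF

noncomputable section

/-! ### Border strips and P-partitions -/

/-- The full alternating step list: `replicate a₁ b ++ replicate a₂ (!b) ++ ⋯`. -/
def fullSteps : List ℕ → Bool → List Bool
  | [], _ => []
  | x :: xs, b => List.replicate x b ++ fullSteps xs (!b)

/-- The step sequence of the border strip `𝒢[a₁,…,aₙ]`: `(a₁−1)` up steps (`true`),
then `a₂` right steps (`false`), then `a₃` up steps, alternating, ending with
`(aₙ−1)` final steps. -/
def steps (a : List ℕ) : List Bool := ((fullSteps a true).drop 1).dropLast

/-- The number of boxes `N = a₁+⋯+aₙ−1` of the border strip `𝒢[a₁,…,aₙ]`. -/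
def boxCount (a : List ℕ) : ℕ := a.sum - 1

/-- `σ` is a P-partition on `𝒢[a₁,…,aₙ]` with parts at most `m`:
`σ(t+1) ≤ σ(t)` on up steps and `σ(t) ≤ σ(t+1)` on right steps. -/
def IsPP (m : ℕ) (a : List ℕ) (σ : Fin (boxCount a) → Fin (m + 1)) : Prop :=
  ∀ (t : ℕ) (h : t + 1 < boxCount a),
    if (steps a).getD t true
    then ((σ ⟨t + 1, h⟩ : ℕ) ≤ (σ ⟨t, Nat.lt_of_succ_lt h⟩ : ℕ))
    else ((σ ⟨t, Nat.lt_of_succ_lt h⟩ : ℕ) ≤ (σ ⟨t + 1, h⟩ : ℕ))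

/-- The set of P-partitions on `𝒢[a₁,…,aₙ]` with parts at most `m`. -/
noncomputable def PP (m : ℕ) (a : List ℕ) : Finset (Fin (boxCount a) → Fin (m + 1)) :=
  @Finset.filter _ (IsPP m a) (Classical.decPred _) Finset.univ

/-- The weight of a P-partition: the sum of its parts. -/
def wt {N m : ℕ} (σ : Fin N → Fin (m + 1)) : ℕ := ∑ t, (σ t : ℕ)

/-- The number of P-partitions (parts at most `m`) satisfying a further predicate `p`. -/
noncomputable def PPcount (m : ℕ) (a : List ℕ)
    (p : (Fin (boxCount a) → Fin (m + 1)) → Prop) : ℕ :=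
  (@Finset.filter _ p (Classical.decPred _) (PP m a)).card

/-- The weight generating function `Σ q^{wt σ}` over P-partitions satisfying `p`. -/
noncomputable def PPgen (m : ℕ) (a : List ℕ)
    (p : (Fin (boxCount a) → Fin (m + 1)) → Prop) : Polynomial ℤ :=
  ∑ σ ∈ @Finset.filter _ p (Classical.decPred _) (PP m a), (X : Polynomial ℤ) ^ wt σ

/-- `Ω_m(𝒢,q)`: the weight generating function of all P-partitions with parts at most `m`. -/
noncomputable def Omega (m : ℕ) (a : List ℕ) : Polynomial ℤ := PPgen m a fun _ => True

/-- Generating function over P-partitions with first part `≤ b` and last part `≤ c`. -/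
noncomputable def OmegaLE (m : ℕ) (a : List ℕ) (b c : ℕ) : Polynomial ℤ :=
  PPgen m a fun σ =>
    (∀ h : 0 < boxCount a, (σ ⟨0, h⟩ : ℕ) ≤ b) ∧
    (∀ h : 0 < boxCount a, (σ ⟨boxCount a - 1, Nat.sub_lt h Nat.one_pos⟩ : ℕ) ≤ c)

/-- Generating function over P-partitions with first part `≤ b` and last part `≥ c`. -/
noncomputable def OmegaGE (m : ℕ) (a : List ℕ) (b c : ℕ) : Polynomial ℤ :=
  PPgen m a fun σ =>
    (∀ h : 0 < boxCount a, (σ ⟨0, h⟩ : ℕ) ≤ b) ∧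
    (∀ h : 0 < boxCount a, c ≤ (σ ⟨boxCount a - 1, Nat.sub_lt h Nat.one_pos⟩ : ℕ))

/-! ### Matrices over ℤ -/

/-- `R_m`, the `(m+1)×(m+1)` upper-triangular matrix of ones. -/
def Rmat (m : ℕ) : Matrix (Fin (m + 1)) (Fin (m + 1)) ℤ :=
  Matrix.of fun i j => if i ≤ j then 1 else 0

/-- `W_m`, the antidiagonal permutation matrix (`(W_m)_{ij} = 1` iff `i+j = m+2`, 1-based). -/
def Wmat (m : ℕ) : Matrix (Fin (m + 1)) (Fin (m + 1)) ℤ :=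
  Matrix.of fun i j => if (i : ℕ) + 1 + ((j : ℕ) + 1) = m + 2 then 1 else 0

/-- `Λ_m(a) = R_m^a · W_m`. -/
def Lam (m a : ℕ) : Matrix (Fin (m + 1)) (Fin (m + 1)) ℤ := Rmat m ^ a * Wmat m

/-- The product `Λ_m(a₁)Λ_m(a₂)⋯Λ_m(aₙ)`. -/
def LamProd (m : ℕ) (a : List ℕ) : Matrix (Fin (m + 1)) (Fin (m + 1)) ℤ :=
  (a.map fun x => Lam m x).prod

/-! ### q-deformed matrices over ℤ[q] (with `q = Polynomial.X`) -/

/-- `R_m` as a matrix over `ℤ[q]`. -/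
def RmatQ (m : ℕ) : Matrix (Fin (m + 1)) (Fin (m + 1)) (Polynomial ℤ) :=
  Matrix.of fun i j => if i ≤ j then 1 else 0

/-- `L_m = R_m^⊤` as a matrix over `ℤ[q]`. -/
def LmatQ (m : ℕ) : Matrix (Fin (m + 1)) (Fin (m + 1)) (Polynomial ℤ) := (RmatQ m).transpose

/-- `Q_m = diag(q^m, q^{m-1}, …, q, 1)`. -/
def Qmat (m : ℕ) : Matrix (Fin (m + 1)) (Fin (m + 1)) (Polynomial ℤ) :=
  Matrix.diagonal fun i => X ^ (m - (i : ℕ))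

/-- `R_m(q) := R_m · Q_m`. -/
def Rq (m : ℕ) : Matrix (Fin (m + 1)) (Fin (m + 1)) (Polynomial ℤ) := RmatQ m * Qmat m

/-- `L_m(q) := L_m · Q_m`. -/
def Lq (m : ℕ) : Matrix (Fin (m + 1)) (Fin (m + 1)) (Polynomial ℤ) := LmatQ m * Qmat m

/-- `W_m` as a matrix over `ℤ[q]`. -/
def WmatQ (m : ℕ) : Matrix (Fin (m + 1)) (Fin (m + 1)) (Polynomial ℤ) :=
  Matrix.of fun i j => if (i : ℕ) + 1 + ((j : ℕ) + 1) = m + 2 then 1 else 0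

/-- `Λ⁺_m(q,a) := R_m(q)^a · W_m`. -/
def LamP (m a : ℕ) : Matrix (Fin (m + 1)) (Fin (m + 1)) (Polynomial ℤ) := Rq m ^ a * WmatQ m

/-- `Λ⁻_m(q,a) := W_m · L_m(q)^a`. -/
def LamM (m a : ℕ) : Matrix (Fin (m + 1)) (Fin (m + 1)) (Polynomial ℤ) := WmatQ m * Lq m ^ a

/-- Alternating product of `Λ⁺`/`Λ⁻` matrices (`b = true` starts with `Λ⁺`). -/
def altLam (m : ℕ) : List ℕ → Bool → Matrix (Fin (m + 1)) (Fin (m + 1)) (Polynomial ℤ)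
  | [], _ => 1
  | x :: xs, b => (if b then LamP m x else LamM m x) * altLam m xs (!b)

/-- `X_𝒢(q) = Λ⁺_m(q,a₁)Λ⁻_m(q,a₂)Λ⁺_m(q,a₃)⋯`. -/
def XG (m : ℕ) (a : List ℕ) : Matrix (Fin (m + 1)) (Fin (m + 1)) (Polynomial ℤ) :=
  altLam m a true

/-- Alternating product of powers of `R_m(q)` and `L_m(q)` (`b = true` starts with `R`). -/
def altRL (m : ℕ) : List ℕ → Bool → Matrix (Fin (m + 1)) (Fin (m + 1)) (Polynomial ℤ)
  | [], _ => 1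
  | x :: xs, b => (if b then Rq m ^ x else Lq m ^ x) * altRL m xs (!b)

/-- `R_m(q)^{a₁} L_m(q)^{a₂} R_m(q)^{a₃} ⋯`. -/
def RLProd (m : ℕ) (a : List ℕ) : Matrix (Fin (m + 1)) (Fin (m + 1)) (Polynomial ℤ) :=
  altRL m a true

/-! ### Gaussian binomial coefficients -/

/-- The Gaussian binomial coefficient `binom(n,k)_q ∈ ℤ[q]`, defined via the
q-Pascal recursion `binom(n,k)_q = binom(n−1,k−1)_q + q^k·binom(n−1,k)_q`;
it equals `[n]_q!/([k]_q![n−k]_q!)`. -/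
def qbinom : ℕ → ℕ → Polynomial ℤ
  | _, 0 => 1
  | 0, _ + 1 => 0
  | n + 1, k + 1 => qbinom n k + X ^ (k + 1) * qbinom n (k + 1)

/-- The q-multichoose coefficient `mbinom(n,k)_q := binom(n+k−1,k)_q`. -/
def qmbinom (n k : ℕ) : Polynomial ℤ := qbinom (n + k - 1) k

/-! ### Higher q-continued fractions -/

/-- The higher q-continued fraction
`r^q_{i,m}(a₁,…,aₙ) := Ω_m^{m+1−i,1}(𝒢,q) · (Ω_m^{m+1,1}(𝒢,q))⁻¹ ∈ ℤ⟦q⟧`,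
i.e. the generating function over P-partitions with first part `≤ i`, divided by the
one over P-partitions with first part `= 0` (whose constant term is `1`). -/
noncomputable def rq (m i : ℕ) (a : List ℕ) : PowerSeries ℤ :=
  (↑(OmegaLE m a i m) : PowerSeries ℤ) *
    PowerSeries.invOfUnit (↑(OmegaLE m a 0 m) : PowerSeries ℤ) 1

/-- The value `v(a₁,…,aₙ)` of a finite continued fraction `a₁ + 1/(a₂ + 1/(⋯))`. -/
def cfVal : List ℕ → ℚ
  | [] => 1
  | [x] => (x : ℚ)
  | x :: y :: xs => (x : ℚ) + 1 / cfVal (y :: xs)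

end

end QHCF

open QHCF

namespace QHCF

/-- The sum over walks of the product of the weights of their steps is a product of matrices. -/
theorem sum_walk_eq_dotProduct {ι R : Type*} [Fintype ι] [DecidableEq ι] [CommSemiring R] {n : ℕ}
    (M : Fin n → Matrix ι ι R) (u v : ι → R) :
    ∑ σ : Fin (n + 1) → ι,
        u (σ 0) * (∏ t, M t (σ t.castSucc) (σ t.succ)) * v (σ (Fin.last n)) =
      u ⬝ᵥ ((List.ofFn M).prod.mulVec v) := by
  induction n generalizing u with
  | zero =>
    rw [← (Equiv.funUnique (Fin 1) ι).symm.sum_comp]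
    simp [dotProduct]
  | succ n ih =>
    have key := ih (fun t => M t.succ) (Matrix.vecMul u (M 0))
    rw [List.ofFn_succ, List.prod_cons, ← Matrix.mulVec_mulVec, Matrix.dotProduct_mulVec, ← key,
      ← (Fin.consEquiv fun _ : Fin (n + 2) => ι).sum_comp, Fintype.sum_prod_type, Finset.sum_comm]
    refine Finset.sum_congr rfl fun τ _ => ?_
    simp only [Matrix.vecMul, dotProduct, Finset.sum_mul]
    refine Finset.sum_congr rfl fun x _ => ?_
    rw [Fin.prod_univ_succ]
    simp [Fin.consEquiv, ← Fin.succ_last, mul_assoc]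

/-- The zero-one matrix of the relation between consecutive parts across a step:
weakly decreasing for an up step (`true`), weakly increasing for a right step. -/
def stepMat (m : ℕ) (b : Bool) : Matrix (Fin (m + 1)) (Fin (m + 1)) ℤ :=
  Matrix.of fun x y => if (if b then y ≤ x else x ≤ y) then 1 else 0

theorem Wmat_apply (m : ℕ) (i j : Fin (m + 1)) : Wmat m i j = if j = i.rev then 1 else 0 := by
  simp only [Wmat, Matrix.of_apply, Fin.ext_iff, Fin.val_rev]
  congr 1
  exact propext (by omega)

theorem Wmat_mul_apply (m : ℕ) (A : Matrix (Fin (m + 1)) (Fin (m + 1)) ℤ) (i j : Fin (m + 1)) :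
    (Wmat m * A) i j = A i.rev j := by
  simp [Matrix.mul_apply, Wmat_apply]

theorem mul_Wmat_apply (m : ℕ) (A : Matrix (Fin (m + 1)) (Fin (m + 1)) ℤ) (i j : Fin (m + 1)) :
    (A * Wmat m) i j = A i j.rev := by
  simp [Matrix.mul_apply, Wmat_apply, eq_comm (a := j), Fin.rev_eq_iff]

theorem Wmat_mul_self (m : ℕ) : Wmat m * Wmat m = 1 := by
  ext i j
  simp [Wmat_mul_apply, Wmat_apply, Matrix.one_apply, eq_comm]

theorem stepMat_false (m : ℕ) : stepMat m false = Rmat m := by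
  ext i j
  simp [stepMat, Rmat]

theorem Wmat_mul_Rmat_pow (m x : ℕ) : Wmat m * Rmat m ^ x = stepMat m true ^ x * Wmat m := by
  have h : SemiconjBy (Wmat m) (Rmat m) (stepMat m true) := by
    ext i j
    rw [Wmat_mul_apply, mul_Wmat_apply]
    simp [stepMat, Rmat, Fin.rev_le_iff]
  exact h.pow_right x

/-- The product of the step matrices of an alternating step list in terms of the `Λ` matrices. -/
theorem prod_stepMat_fullSteps (m : ℕ) (a : List ℕ) (b : Bool) :
    (if b then Wmat m else 1) * LamProd m a =
      ((fullSteps a b).map (stepMat m)).prod *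
        (if b = decide (Even a.length) then Wmat m else 1) := by
  induction a generalizing b with
  | nil => cases b <;> simp [LamProd, fullSteps]
  | cons x xs ih =>
    have hcons : LamProd m (x :: xs) = Rmat m ^ x * Wmat m * LamProd m xs := by
      simp [LamProd, Lam]
    have hb : (b = decide (Even (x :: xs).length)) = ((!b) = decide (Even xs.length)) := by
      cases b <;> simp [Nat.even_add_one]
    simp only [hb, fullSteps, List.map_append, List.prod_append, List.map_replicate,
      List.prod_replicate, mul_assoc, ← ih, hcons]
    cases b
    · simp [stepMat_false]
    · simp only [if_true, Bool.not_true, Bool.false_eq_true, if_false, one_mul]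
      rw [← mul_assoc, Wmat_mul_Rmat_pow, mul_assoc, ← mul_assoc (Wmat m), Wmat_mul_self, one_mul]

theorem length_fullSteps (a : List ℕ) (b : Bool) : (fullSteps a b).length = a.sum := by
  induction a generalizing b with
  | nil => rfl
  | cons x xs ih => simp [fullSteps, ih]

theorem exists_fullSteps_eq_concat {a : List ℕ} (ha : a ≠ []) (hpos : ∀ x ∈ a, 0 < x) (b : Bool) :
    ∃ l, fullSteps a b = l ++ [b ^^ decide (Even a.length)] := by
  induction a generalizing b with
  | nil => exact absurd rfl ha
  | cons x xs ih =>
    rcases eq_or_ne xs [] with rfl | hxs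
    · obtain ⟨y, rfl⟩ := Nat.exists_eq_succ_of_ne_zero (hpos x (by simp)).ne'
      exact ⟨List.replicate y b, by simp [fullSteps, List.replicate_succ']⟩
    · obtain ⟨l, hl⟩ := ih hxs (fun y hy => hpos y (by simp [hy])) (!b)
      refine ⟨List.replicate x b ++ l, ?_⟩
      rw [fullSteps, hl, List.append_assoc]
      cases b <;> simp [Nat.even_add_one, -Nat.not_even_iff_odd]

theorem fullSteps_eq_steps {a : List ℕ} (ha : a ≠ []) (hpos : ∀ x ∈ a, 0 < x)
    (hN : 0 < boxCount a) :
    fullSteps a true = true :: (steps a ++ [!decide (Even a.length)]) := by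
  obtain ⟨l, hl⟩ := exists_fullSteps_eq_concat ha hpos true
  have hlen := length_fullSteps a true
  obtain ⟨l', hl'⟩ : ∃ l', fullSteps a true = true :: l' := by
    obtain _ | ⟨x, xs⟩ := a
    · exact absurd rfl ha
    · obtain ⟨y, rfl⟩ := Nat.exists_eq_succ_of_ne_zero (hpos x (by simp)).ne'
      exact ⟨_, rfl⟩
  unfold boxCount at hN
  obtain _ | ⟨c, l⟩ := l
  · simp [hl] at hlen
    omega
  · obtain ⟨rfl, rfl⟩ : c = true ∧ l ++ [!decide (Even a.length)] = l' := by
      simpa using hl.symm.trans hl'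
    simp [steps, hl']

open Classical in
/-- Fillings of a strip with prescribed steps and prescribed bounds on the first and last part,
counted by a product of step matrices. -/
theorem sum_ite_eq_prod_stepMat {m N : ℕ} (l : List Bool) (hlen : l.length + 1 = N) (hN : 0 < N)
    (b c : Bool) (x y : Fin (m + 1)) :
    (∑ σ : Fin N → Fin (m + 1),
      if (∀ (t : ℕ) (h : t + 1 < N),
          if l.getD t true then (σ ⟨t + 1, h⟩ : ℕ) ≤ (σ ⟨t, Nat.lt_of_succ_lt h⟩ : ℕ)
          else (σ ⟨t, Nat.lt_of_succ_lt h⟩ : ℕ) ≤ (σ ⟨t + 1, h⟩ : ℕ)) ∧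
        (if b then σ ⟨0, hN⟩ ≤ x else x ≤ σ ⟨0, hN⟩) ∧
        (if c then y ≤ σ ⟨N - 1, Nat.sub_lt hN Nat.one_pos⟩
          else σ ⟨N - 1, Nat.sub_lt hN Nat.one_pos⟩ ≤ y)
      then (1 : ℤ) else 0) = ((b :: (l ++ [c])).map (stepMat m)).prod x y := by
  subst hlen
  have hentry : ((b :: (l ++ [c])).map (stepMat m)).prod x y =
      stepMat m b x ⬝ᵥ ((l.map (stepMat m)).prod.mulVec fun z => stepMat m c z y) := by
    simp [Matrix.mul_apply, dotProduct, Matrix.mulVec]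
  have hprod : l.map (stepMat m) = List.ofFn fun t : Fin l.length => stepMat m l[t] := by
    simp
  rw [hentry, hprod, ← sum_walk_eq_dotProduct]
  refine Finset.sum_congr rfl fun σ _ => ?_
  simp only [stepMat, Matrix.of_apply, Finset.prod_boole, ← ite_and, mul_ite, mul_one, mul_zero]
  refine if_congr ?_ rfl rfl
  have hstep : (∀ (t : ℕ) (h : t + 1 < l.length + 1),
        if l.getD t true then (σ ⟨t + 1, h⟩ : ℕ) ≤ (σ ⟨t, Nat.lt_of_succ_lt h⟩ : ℕ)
        else (σ ⟨t, Nat.lt_of_succ_lt h⟩ : ℕ) ≤ (σ ⟨t + 1, h⟩ : ℕ)) ↔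
      ∀ t ∈ (Finset.univ : Finset (Fin l.length)),
        if l[t] then σ t.succ ≤ σ t.castSucc else σ t.castSucc ≤ σ t.succ := by
    simp only [Finset.mem_univ, true_imp_iff, Fin.forall_iff, Nat.add_lt_add_iff_right]
    refine forall₂_congr fun t h => ?_
    rw [List.getD_eq_getElem _ _ h]
    rfl
  rw [hstep]
  exact ⟨fun ⟨h₁, h₂, h₃⟩ => ⟨h₃, h₁, h₂⟩, fun ⟨h₃, h₁, h₂⟩ => ⟨h₁, h₂, h₃⟩⟩

/-- P-partitions with prescribed bounds on the first and last part, counted by a product of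
step matrices. -/
theorem PPcount_eq_prod_stepMat {m : ℕ} {a : List ℕ} (hN : 0 < boxCount a)
    (hlen : (steps a).length + 1 = boxCount a) (b c : Bool) (x y : Fin (m + 1)) :
    ((PPcount m a fun σ =>
        (if b then σ ⟨0, hN⟩ ≤ x else x ≤ σ ⟨0, hN⟩) ∧
        (if c then y ≤ σ ⟨boxCount a - 1, Nat.sub_lt hN Nat.one_pos⟩
          else σ ⟨boxCount a - 1, Nat.sub_lt hN Nat.one_pos⟩ ≤ y) : ℕ) : ℤ) =
      ((b :: (steps a ++ [c])).map (stepMat m)).prod x y := by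
  rw [← sum_ite_eq_prod_stepMat (steps a) hlen hN, PPcount, PP, Finset.filter_filter,
    Finset.card_filter]
  push_cast
  refine Finset.sum_congr rfl fun σ _ => ?_
  congr

end QHCF

/-- Theorem 3.8 of [MOSZ23], restated.  For a sequence of positive
integers `(a₁,…,aₙ)` with border strip `𝒢 = 𝒢[a₁,…,aₙ]` and
`X = Λ_m(a₁)Λ_m(a₂)⋯Λ_m(aₙ)`, the entry `X_{ij}` (1-based indices) counts P-partitions
`σ` on `𝒢` with parts at most `m` such that `σ(1) ≤ m+1−i` and `σ(N) ≤ m+1−j` (if `n`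
is even), resp. `σ(1) ≤ m+1−i` and `σ(N) ≥ j−1` (if `n` is odd).  In particular
`X_{11}` is the total number of P-partitions on `𝒢` with parts at most `m`. -/
theorem statement0 (m : ℕ) (hm : 1 ≤ m) (a : List ℕ) (ha : a ≠ [])
    (hpos : ∀ x ∈ a, 0 < x) (hN : 0 < boxCount a)
    (i j : ℕ) (hi1 : 1 ≤ i) (hi2 : i ≤ m + 1) (hj1 : 1 ≤ j) (hj2 : j ≤ m + 1) :
    (Even a.length →
      LamProd m a ⟨i - 1, by omega⟩ ⟨j - 1, by omega⟩ =
        ((PPcount m a fun σ =>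
          (σ ⟨0, hN⟩ : ℕ) ≤ m + 1 - i ∧
          (σ ⟨boxCount a - 1, Nat.sub_lt hN Nat.one_pos⟩ : ℕ) ≤ m + 1 - j) : ℤ)) ∧
    (¬ Even a.length →
      LamProd m a ⟨i - 1, by omega⟩ ⟨j - 1, by omega⟩ =
        ((PPcount m a fun σ =>
          (σ ⟨0, hN⟩ : ℕ) ≤ m + 1 - i ∧
          j - 1 ≤ (σ ⟨boxCount a - 1, Nat.sub_lt hN Nat.one_pos⟩ : ℕ)) : ℤ)) ∧
    LamProd m a 0 0 = ((PP m a).card : ℤ) := by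
  have hfull := fullSteps_eq_steps ha hpos hN
  have hlen : (steps a).length + 1 = boxCount a := by
    have h := length_fullSteps a true
    simp only [hfull, List.length_cons, List.length_append, List.length_nil] at h
    unfold boxCount
    omega
  have hmat := prod_stepMat_fullSteps m a true
  rw [hfull] at hmat
  have hentry (x y : Fin (m + 1)) : LamProd m a x y = (PPcount m a fun σ =>
      σ ⟨0, hN⟩ ≤ x.rev ∧
      (if Even a.length then σ ⟨boxCount a - 1, Nat.sub_lt hN Nat.one_pos⟩ ≤ y.rev
        else y ≤ σ ⟨boxCount a - 1, Nat.sub_lt hN Nat.one_pos⟩) : ℕ) := by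
    have h := congrFun₂ hmat x.rev y
    rw [if_pos rfl, Wmat_mul_apply, Fin.rev_rev] at h
    rw [h]
    by_cases he : Even a.length
    · have := PPcount_eq_prod_stepMat hN hlen true false x.rev y.rev
      simp_all [mul_Wmat_apply]
    · have := PPcount_eq_prod_stepMat hN hlen true true x.rev y
      simp_all [-Nat.not_even_iff_odd]
  refine ⟨fun he => ?_, fun he => ?_, ?_⟩
  · rw [hentry]
    simp only [he, if_true, Fin.le_def, Fin.val_rev]
    congr! 6 <;> omega
  · rw [hentry]
    simp only [he, if_false, Fin.le_def, Fin.val_rev]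
    congr! 6
    omega
  · rw [hentry, PPcount]
    congr 2
    ext σ
    simp [Fin.le_last]
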